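/- Let p_X be a probability measure on ℝ with finite second moment, and let R, R_c ∈ [0,∞]. Then D_e(R,R_c) ≥ D(R,R_c,∞) ≥ D_e(R,∞), where D(R,R_c,∞) is the distortion-rate-perception function without perception constraint and D_e is the deterministic-decoder (entropy-constrained quantization) counterpart. -/

import Mathlib

open MeasureTheory ProbabilityTheory Real Set
open scoped ENNReal NNReal

noncomputable section

open Classical in
/-- Kullback-Leibler divergence of `q` from `p`, in `[0,∞]`. -/
def KLD {α : Type*} [MeasurableSpace α] (q p : Measure α) : ℝ≥0∞ :=
  if q ≪ p ∧ Integrable (fun x => Real.log (q.rnDeriv p x).toReal) q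
  then ENNReal.ofReal (∫ x, Real.log (q.rnDeriv p x).toReal ∂q) else ⊤

/-- Mutual information between `f` and `g` under `μ`. -/
def mutInfo {Ω α β : Type*} [MeasurableSpace Ω] [MeasurableSpace α] [MeasurableSpace β]
    (μ : Measure Ω) (f : Ω → α) (g : Ω → β) : ℝ≥0∞ :=
  KLD (μ.map (fun ω => (f ω, g ω))) ((μ.map f).prod (μ.map g))

/-- Squared Wasserstein-2 distance. -/
def W2sq (p q : Measure ℝ) : ℝ≥0∞ :=
  ⨅ (cpl : Measure (ℝ × ℝ)) (_ : IsProbabilityMeasure cpl) (_ : cpl.map Prod.fst = p)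
    (_ : cpl.map Prod.snd = q), ∫⁻ xy, ENNReal.ofReal ((xy.1 - xy.2) ^ 2) ∂cpl

/-- `exp(-x)` for `x ∈ [0,∞]`, with `exp(-∞) = 0`. -/
def expNeg (x : ℝ≥0∞) : ℝ := if x = ⊤ then 0 else Real.exp (-x.toReal)

/-- Feasibility predicate for the distortion-rate-perception function. -/
def DRPfeasible (pX : Measure ℝ) (φ : Measure ℝ → Measure ℝ → ℝ≥0∞) (R Rc P : ℝ≥0∞)
    (μ : Measure (ℝ × ℝ × ℝ)) : Prop :=
  ∃ hμ : IsProbabilityMeasure μ,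
    μ.map (fun w => w.1) = pX ∧
    (haveI := hμ
     CondIndepFun (MeasurableSpace.comap (fun w : ℝ × ℝ × ℝ => w.2.1) inferInstance)
      ((measurable_fst.comp measurable_snd).comap_le)
      (fun w : ℝ × ℝ × ℝ => w.1) (fun w : ℝ × ℝ × ℝ => w.2.2) μ) ∧
    mutInfo μ (fun w => w.1) (fun w => w.2.1) ≤ R ∧
    mutInfo μ (fun w => w.2.2) (fun w => w.2.1) ≤ R + Rc ∧
    φ pX (μ.map (fun w => w.2.2)) ≤ P

/-- Mean squared distortion of a joint law of `(X, U, X̂)`. -/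
def distortion (μ : Measure (ℝ × ℝ × ℝ)) : ℝ≥0∞ :=
  ∫⁻ w, ENNReal.ofReal ((w.1 - w.2.2) ^ 2) ∂μ

/-- The distortion-rate-perception function `D(R, R_c, P | φ)`. -/
def DRP (pX : Measure ℝ) (φ : Measure ℝ → Measure ℝ → ℝ≥0∞) (R Rc P : ℝ≥0∞) : ℝ≥0∞ :=
  ⨅ (μ : Measure (ℝ × ℝ × ℝ)) (_ : DRPfeasible pX φ R Rc P μ), distortion μ

/-- `D(R, R_c, ∞)`: the DRP function without perception constraint. -/
def DRPinf (pX : Measure ℝ) (R Rc : ℝ≥0∞) : ℝ≥0∞ :=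
  DRP pX (fun _ _ => 0) R Rc ⊤

/-- Deterministic-decoder (entropy-constrained quantization) function `D_e(R, R_c)`,
with `H(X̂) := I(X̂; X̂)`. -/
def De (pX : Measure ℝ) (R Rc : ℝ≥0∞) : ℝ≥0∞ :=
  ⨅ (cpl : Measure (ℝ × ℝ)) (_ : IsProbabilityMeasure cpl ∧ cpl.map Prod.fst = pX ∧
      mutInfo cpl Prod.fst Prod.snd ≤ R ∧ mutInfo cpl Prod.snd Prod.snd ≤ R + Rc),
    ∫⁻ w, ENNReal.ofReal ((w.1 - w.2) ^ 2) ∂cpl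

/-- The Gaussian measure `N(μ, σ²)`. -/
def gauss (μ σ : ℝ) : Measure ℝ := gaussianReal μ ⟨σ ^ 2, sq_nonneg σ⟩

end
noncomputable section

/-- `ξ(R, R_c) = √((1 - e^{-2R})(1 - e^{-2(R+R_c)}))`. -/
def xiRRc (R Rc : ℝ≥0∞) : ℝ :=
  Real.sqrt ((1 - expNeg (2 * R)) * (1 - expNeg (2 * (R + Rc))))

/-- `ψ(σ) = log(σ_X/σ) + (σ² - σ_X²)/(2σ_X²)`. -/
def psi (σX s : ℝ) : ℝ := Real.log (σX / s) + (s ^ 2 - σX ^ 2) / (2 * σX ^ 2)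

/-- `δ₊(σ̂, α)` from the improved lower bound. -/
def deltaPlus (σX : ℝ) (R Rc : ℝ≥0∞) (P s α : ℝ) : ℝ :=
  max (σX * expNeg (R + Rc) -
    Real.sqrt (σX ^ 2 - α * (σX ^ 2 + s ^ 2 - P) + α ^ 2 * s ^ 2)) 0 / α

/-- The inner `sup` over `α > 0` in the improved lower bound `D̲'`. -/
def DlowerPrimeFun (σX : ℝ) (R Rc : ℝ≥0∞) (P s : ℝ) : ℝ :=
  sSup ((fun α => σX ^ 2 + s ^ 2 - 2 * σX *
    Real.sqrt ((1 - expNeg (2 * R)) * (s ^ 2 - deltaPlus σX R Rc P s α ^ 2))) '' Set.Ioi 0)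

/-- The improved explicit lower bound `D̲'(R, R_c, P | W₂²)`. -/
def DlowerPrime (σX : ℝ) (R Rc : ℝ≥0∞) (P : ℝ) : ℝ :=
  sInf (DlowerPrimeFun σX R Rc P '' Set.Icc (max (σX - Real.sqrt P) 0) σX)

/-- The explicit lower bound `D̲(R, R_c, P | W₂²)` of Xie et al. -/
def DlowerW2 (σX : ℝ) (R Rc : ℝ≥0∞) (P : ℝ) : ℝ :=
  sInf ((fun s => σX ^ 2 + s ^ 2 - 2 * σX *
      Real.sqrt ((1 - expNeg (2 * R)) *
        (s ^ 2 - max (σX * expNeg (R + Rc) - Real.sqrt P) 0 ^ 2)))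
    '' Set.Icc (max (σX - Real.sqrt P) 0) σX)

end

lemma KLD_eq_klDiv {α : Type*} [MeasurableSpace α] (q p : Measure α)
    [IsProbabilityMeasure q] [IsProbabilityMeasure p] :
    KLD q p = InformationTheory.klDiv q p := by
  rw [InformationTheory.klDiv_def, KLD]
  have h : (fun x => Real.log (q.rnDeriv p x).toReal) = llr q p := rfl
  rw [h]
  simp

lemma mutInfo_le_of_condIndep (μ : Measure (ℝ × ℝ × ℝ)) [IsProbabilityMeasure μ]
    {f g k : ℝ × ℝ × ℝ → ℝ} (hf : Measurable f) (hg : Measurable g) (hk : Measurable k)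
    (h : f ⟂ᵢ[k, hk; μ] g) : mutInfo μ f g ≤ mutInfo μ f k := by
  have : IsProbabilityMeasure (μ.map f) := Measure.isProbabilityMeasure_map hf.aemeasurable
  have : IsProbabilityMeasure (μ.map g) := Measure.isProbabilityMeasure_map hg.aemeasurable
  have : IsProbabilityMeasure (μ.map k) := Measure.isProbabilityMeasure_map hk.aemeasurable
  have : IsProbabilityMeasure (μ.map fun ω => (f ω, g ω)) :=
    Measure.isProbabilityMeasure_map (hf.prodMk hg).aemeasurable
  have : IsProbabilityMeasure (μ.map fun ω => (f ω, k ω)) :=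
    Measure.isProbabilityMeasure_map (hf.prodMk hk).aemeasurable
  rw [mutInfo, mutInfo, KLD_eq_klDiv, KLD_eq_klDiv]
  rw [condIndepFun_iff_map_prod_eq_prod_condDistrib_prod_condDistrib hf hg hk] at h
  have h1 : μ.map (fun ω => (f ω, g ω)) =
      (condDistrib f k μ ×ₖ condDistrib g k μ) ∘ₘ μ.map k := by
    have h' := congrArg (fun ν => ν.map Prod.snd) h
    rw [Measure.map_map measurable_snd (by fun_prop), Measure.map_comp _ _ measurable_snd,
      ← Kernel.snd_eq, Kernel.snd_prod] at h'
    exact h'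
  have h2 : μ.map (fun ω => (f ω, k ω)) = (condDistrib f k μ ×ₖ Kernel.id) ∘ₘ μ.map k := by
    have h' := (compProd_map_condDistrib (mβ := inferInstance) (X := k) (μ := μ) hf.aemeasurable)
    rw [Measure.compProd_eq_comp_prod] at h'
    have h'' := congrArg (fun ν => ν.map Prod.swap) h'
    rw [Measure.map_map measurable_swap (by fun_prop), Measure.map_comp _ _ measurable_swap,
      Kernel.map_prod_swap] at h''
    exact h''.symm
  have h3 : μ.map (fun ω => (f ω, g ω)) =
      (Kernel.id ∥ₖ condDistrib g k μ) ∘ₘ μ.map (fun ω => (f ω, k ω)) := by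
    rw [h1, h2, Measure.comp_assoc, Kernel.parallelComp_comp_prod, Kernel.id_comp, Kernel.comp_id]
  have h4 : (μ.map f).prod (μ.map g) =
      (Kernel.id ∥ₖ condDistrib g k μ) ∘ₘ ((μ.map f).prod (μ.map k)) := by
    rw [← Measure.prod_comp_right, condDistrib_comp_map hk.aemeasurable hg.aemeasurable]
  rw [h3, h4]
  exact InformationTheory.klDiv_comp_right_le _ _ _

/-- `D_e(R, R_c) ≥ D(R, R_c, ∞) ≥ D_e(R, ∞)`. -/
theorem stmt15 (pX : Measure ℝ) (hpX : IsProbabilityMeasure pX)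
    (hm2 : Integrable (fun x => x ^ 2) pX) (R Rc : ℝ≥0∞) :
    De pX R Rc ≥ DRPinf pX R Rc ∧ DRPinf pX R Rc ≥ De pX R ⊤ := by
  constructor
  · refine le_iInf₂ fun cpl ⟨hc, h1, h2, h3⟩ => ?_
    have hT : Measurable (fun w : ℝ × ℝ => (w.1, w.2, w.2)) := by fun_prop
    have hp : IsProbabilityMeasure (cpl.map (fun w : ℝ × ℝ => (w.1, w.2, w.2))) :=
      Measure.isProbabilityMeasure_map hT.aemeasurable
    refine iInf₂_le_of_le (cpl.map (fun w : ℝ × ℝ => (w.1, w.2, w.2))) ⟨hp, ?_, ?_, ?_, ?_, ?_⟩ ?_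
    · rw [Measure.map_map (by fun_prop) hT]; exact h1
    · have h := condIndepFun_self_right (μ := cpl.map (fun w : ℝ × ℝ => (w.1, w.2, w.2)))
        (X := fun w : ℝ × ℝ × ℝ => w.1) (Z := fun w : ℝ × ℝ × ℝ => w.2.1)
        (by fun_prop) (by fun_prop)
      rw [condIndepFun_iff_map_prod_eq_prod_condDistrib_prod_condDistrib
        (by fun_prop) (by fun_prop) (by fun_prop)] at h ⊢
      have hae : (fun w : ℝ × ℝ × ℝ => w.2.2) =ᵐ[cpl.map (fun w : ℝ × ℝ => (w.1, w.2, w.2))]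
          (fun w => w.2.1) := by
        rw [Filter.EventuallyEq, ae_map_iff hT.aemeasurable
          (measurableSet_eq_fun (by fun_prop) (by fun_prop))]
        simp
      rw [condDistrib_congr_left hae, ← h]
      refine Measure.map_congr ?_
      filter_upwards [hae] with w hw
      rw [hw]
    · rw [mutInfo, Measure.map_map (by fun_prop) hT, Measure.map_map (by fun_prop) hT,
        Measure.map_map (by fun_prop) hT]
      exact h2
    · rw [mutInfo, Measure.map_map (by fun_prop) hT, Measure.map_map (by fun_prop) hT,
        Measure.map_map (by fun_prop) hT]
      exact h3
    · exact bot_le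
    · rw [distortion, lintegral_map (by fun_prop) hT]
  · refine le_iInf₂ fun μ ⟨hμ, h1, h2, h3, h4, _⟩ => ?_
    have hT : Measurable (fun w : ℝ × ℝ × ℝ => (w.1, w.2.2)) := by fun_prop
    refine iInf₂_le_of_le (μ.map (fun w : ℝ × ℝ × ℝ => (w.1, w.2.2)))
      ⟨Measure.isProbabilityMeasure_map hT.aemeasurable, ?_, ?_, ?_⟩ ?_
    · rw [Measure.map_map (by fun_prop) hT]; exact h1
    · refine le_trans ?_ h3
      rw [mutInfo, Measure.map_map (by fun_prop) hT, Measure.map_map (by fun_prop) hT,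
        Measure.map_map (by fun_prop) hT]
      exact mutInfo_le_of_condIndep μ (by fun_prop) (by fun_prop) (by fun_prop) h2
    · simp
    · rw [distortion, lintegral_map (by fun_prop) hT]
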